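/- The standard monomials in the regular functions {p(A,B) : (A,B) ∈ H_p} ∪ {u(I) : I ∈ H_u} ∪ {ξ(J) : J ∈ H_ξ} (including the empty monomial 1) are linearly independent over K as elements of K[X]. -/

import Mathlib

namespace SMB

/-- `geTup f g` : the strictly increasing tuple `f` is `≥` the strictly increasing tuple `g`
in the order on increasing tuples: the length of `f` is at most that of `g`, and `f` is
entrywise `≥` `g` (on the common range of indices). -/
def geTup {N s s' : ℕ} (f : Fin s → Fin N) (g : Fin s' → Fin N) : Prop :=
  ∃ h : s ≤ s', ∀ j : Fin s, g (Fin.castLE h j) ≤ f j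

/-- A strictly increasing `s`-tuple with values in `{1,…,N}` (encoded as `Fin N`). -/
structure IncTup (s N : ℕ) where
  f : Fin s → Fin N
  mono : StrictMono f

/-- A pair of strictly increasing tuples of a common length `s`: row indices in `{1,…,m}`
and column indices in `{1,…,q}`, indexing an `s × s` minor. -/
structure PairIx (m q : ℕ) where
  s : ℕ
  rows : Fin s → Fin m
  cols : Fin s → Fin q
  rmono : StrictMono rows
  cmono : StrictMono cols

/-- The partial order `(A,B) ⪰ (A',B')` on pairs of increasing tuples: `A ≥ A'` and `B ≥ B'`. -/
def PairIx.ge {m q : ℕ} (x y : PairIx m q) : Prop :=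
  geTup x.rows y.rows ∧ geTup x.cols y.cols

end SMB
namespace SMB

variable (K : Type) [Field K] (n m q : ℕ)

/-- The coordinate ring `K[X]` of `X = M_{m,n}(K) × M_{n,q}(K)`: the polynomial ring over `K`
in the entries of a generic `m×n` matrix `U` and a generic `n×q` matrix `W`. -/
abbrev KX := MvPolynomial ((Fin m × Fin n) ⊕ (Fin n × Fin q)) K

/-- The generic `m×n` matrix `U = (u_{ij})`. -/
noncomputable def Ugen : Matrix (Fin m) (Fin n) (KX K n m q) :=
  Matrix.of fun i j => MvPolynomial.X (Sum.inl (i, j))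

/-- The generic `n×q` matrix `W = (ξ_{kl})`. -/
noncomputable def Wgen : Matrix (Fin n) (Fin q) (KX K n m q) :=
  Matrix.of fun k l => MvPolynomial.X (Sum.inr (k, l))

/-- `φ_{ij}`, the `(i,j)` entry of the product matrix `UW`. -/
noncomputable def phi (i : Fin m) (j : Fin q) : KX K n m q :=
  (Ugen K n m q * Wgen K n m q) i j

/-- Evaluation of a polynomial in `K[X]` at a point `(U, W) ∈ X`. -/
noncomputable def evalX (U : Matrix (Fin m) (Fin n) K) (W : Matrix (Fin n) (Fin q) K) :
    KX K n m q →+* K :=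
  MvPolynomial.eval (Sum.elim (fun p => U p.1 p.2) (fun p => W p.1 p.2))

variable {K n m q}

/-- `f ∈ K[X]` is invariant under the diagonal action of `GL_n(K)`:
`f(UA, A⁻¹W) = f(U, W)` for all `A ∈ GL_n(K)` and all `(U,W) ∈ X`. -/
def IsGLInvariant (f : KX K n m q) : Prop :=
  ∀ (A : GL (Fin n) K) (U : Matrix (Fin m) (Fin n) K) (W : Matrix (Fin n) (Fin q) K),
    evalX K n m q (U * (A : Matrix (Fin n) (Fin n) K))
      (((A⁻¹ : GL (Fin n) K) : Matrix (Fin n) (Fin n) K) * W) f = evalX K n m q U W f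

/-- `f ∈ K[X]` is invariant under the diagonal action of `SL_n(K)`:
`f(UA, A⁻¹W) = f(U, W)` for all `A ∈ SL_n(K)` and all `(U,W) ∈ X`. -/
def IsSLInvariant (f : KX K n m q) : Prop :=
  ∀ (A : Matrix.SpecialLinearGroup (Fin n) K)
    (U : Matrix (Fin m) (Fin n) K) (W : Matrix (Fin n) (Fin q) K),
    evalX K n m q (U * (A : Matrix (Fin n) (Fin n) K))
      (((A⁻¹ : Matrix.SpecialLinearGroup (Fin n) K) : Matrix (Fin n) (Fin n) K) * W) f
      = evalX K n m q U W f

variable (K n m q)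

end SMB
namespace SMB

variable (K : Type) [Field K] (n m q : ℕ)

/-- `p(A,B)`: the minor of the product matrix `UW` with row indices `A` and column indices `B`. -/
noncomputable def pPoly (x : PairIx m q) : KX K n m q :=
  Matrix.det (Matrix.of fun i j : Fin x.s =>
    (Ugen K n m q * Wgen K n m q) (x.rows i) (x.cols j))

/-- `u(I)`: the maximal (`n×n`) minor of `U` with row indices `I`. -/
noncomputable def uPoly (I : Fin n → Fin m) : KX K n m q :=
  Matrix.det (Matrix.of fun i j : Fin n => MvPolynomial.X (Sum.inl (I i, j)))

/-- `ξ(J)`: the maximal (`n×n`) minor of `W` with column indices `J`. -/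
noncomputable def xiPoly (J : Fin n → Fin q) : KX K n m q :=
  Matrix.det (Matrix.of fun i j : Fin n => MvPolynomial.X (Sum.inr (i, J j)))

end SMB
namespace SMB

variable (n m q : ℕ)

/-- The index set `H = H_u ⊔ H_ξ ⊔ H_p`, where `H_u = I(n,m)`, `H_ξ = I(n,q)` and
`H_p = ⋃_{1 ≤ r ≤ n} I(r,m) × I(r,q)`. -/
abbrev HElt := IncTup n m ⊕ (IncTup n q ⊕ {x : PairIx m q // 0 < x.s ∧ x.s ≤ n})

variable {n m q}

/-- The partial order on `H`: componentwise order on `H_u` and on `H_ξ`; the order `⪰` on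
`H_p`; elements of `H_u` and `H_ξ` mutually incomparable; no element of `H_u ∪ H_ξ` above
any element of `H_p`; `I ≤ (A,B)` iff `I ≤ A`, and `J ≤ (A,B)` iff `J ≤ B`. -/
def hle : HElt n m q → HElt n m q → Prop
  | Sum.inl I, Sum.inl I' => ∀ j, I.f j ≤ I'.f j
  | Sum.inl I, Sum.inr (Sum.inr P) => geTup P.val.rows I.f
  | Sum.inr (Sum.inl J), Sum.inr (Sum.inl J') => ∀ j, J.f j ≤ J'.f j
  | Sum.inr (Sum.inl J), Sum.inr (Sum.inr P) => geTup P.val.cols J.f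
  | Sum.inr (Sum.inr P), Sum.inr (Sum.inr P') => PairIx.ge P'.val P.val
  | _, _ => False

end SMB
namespace SMB

variable (K : Type) [Field K] (n m q : ℕ)

/-- The regular function on `X` attached to an element of `H`:
`u(I)` for `I ∈ H_u`, `ξ(J)` for `J ∈ H_ξ`, and `p(A,B)` for `(A,B) ∈ H_p`. -/
noncomputable def polyOf : HElt n m q → KX K n m q
  | Sum.inl I => uPoly K n m q I.f
  | Sum.inr (Sum.inl J) => xiPoly K n m q J.f
  | Sum.inr (Sum.inr P) => pPoly K n m q P.val

variable {n m q}

/-- A list of elements of `H` indexes a standard monomial iff it does not involve both some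
`u(I)` and some `ξ(J)`, and it is weakly decreasing for the partial order on `H`. -/
def IsStandardList (L : List (HElt n m q)) : Prop :=
  (¬ ((∃ I : IncTup n m, Sum.inl I ∈ L) ∧
      (∃ J : IncTup n q, Sum.inr (Sum.inl J) ∈ L))) ∧
  L.Chain' fun a b => hle b a

end SMB

/-- Distinct naturals indexed by `Fin s` sum to at least `0 + 1 + ⋯ + (s - 1)`. -/
theorem sum_val_le_sum_of_injective {s : ℕ} (τ : Fin s → ℕ) (hτ : Function.Injective τ) :
    ∑ i : Fin s, ((i : ℕ) : ℤ) ≤ ∑ i, (τ i : ℤ) := by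
  have hinj : Function.Injective fun i => (τ i : ℤ) := fun a b h => hτ (by simpa using h)
  have h := Finset.sum_range_le_sum (s := Finset.univ.image fun i => (τ i : ℤ)) (c := 0)
    (by simp)
  rw [Finset.card_image_of_injective _ hinj, Finset.sum_image (fun a _ b _ h => hinj h)] at h
  rw [Fin.sum_univ_eq_sum_range (fun i => (i : ℤ)) s]
  simpa using h

/-- Strict rearrangement: among the injections `τ : Fin s → ℕ`, the sum `∑ i, α i * τ i` against a
positive strictly decreasing sequence `α` is minimized exactly at the inclusion. -/
theorem eq_val_or_sum_mul_lt {s : ℕ} (α : Fin s → ℤ) (hα : StrictAnti α) (hpos : ∀ i, 0 < α i)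
    (τ : Fin s → ℕ) (hτ : Function.Injective τ) :
    (∀ i, τ i = i) ∨ ∑ i, α i * ((i : ℕ) : ℤ) < ∑ i, α i * (τ i : ℤ) := by
  induction s with
  | zero => exact Or.inl fun i => i.elim0
  | succ s ih =>
    set c := α (Fin.last s) with hc
    have hcpos : 0 < c := hpos _
    have key := ih (fun i => α i.castSucc - c)
      (fun i j hij => sub_lt_sub_right (hα (Fin.castSucc_lt_castSucc_iff.2 hij)) c)
      (fun i => sub_pos.2 (hα (Fin.castSucc_lt_last i))) (fun i => τ i.castSucc)
      (hτ.comp (Fin.castSucc_injective s))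
    have hsum := sum_val_le_sum_of_injective τ hτ
    have split : ∀ g : Fin (s + 1) → ℤ, ∑ i, α i * g i =
        ∑ i : Fin s, (α i.castSucc - c) * g i.castSucc + c * ∑ i, g i := by
      intro g
      rw [Fin.sum_univ_castSucc, Fin.sum_univ_castSucc, mul_add, Finset.mul_sum, ← add_assoc,
        ← Finset.sum_add_distrib]
      congr 1
      exact Finset.sum_congr rfl fun i _ => by ring
    rw [split, split]
    have hmul := mul_le_mul_of_nonneg_left hsum hcpos.le
    rcases key with key | key
    · rcases hsum.eq_or_lt with he | hl
      · left
        rw [Fin.sum_univ_castSucc, Fin.sum_univ_castSucc] at he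
        simp only [key, Fin.val_castSucc, add_right_inj] at he
        intro i
        refine Fin.lastCases ?_ (fun i => ?_) i
        · exact_mod_cast he.symm
        · simpa using key i
      · right
        have := mul_lt_mul_of_pos_left hl hcpos
        simp only [key, Fin.val_castSucc]
        linarith
    · right
      simp only [Fin.val_castSucc]
      linarith

/-- `HasInitial w f d`: the monomial `d` occurs in `f` with coefficient `1`, and its weight is
strictly smaller than that of every other monomial of `f`. -/
def HasInitial {K σ : Type*} [CommSemiring K] (w : (σ →₀ ℕ) →+ ℤ) (f : MvPolynomial σ K)
    (d : σ →₀ ℕ) : Prop :=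
  f.coeff d = 1 ∧ ∀ e, f.coeff e ≠ 0 → e ≠ d → w d < w e

section HasInitial

variable {K σ : Type*} [CommRing K] {w : (σ →₀ ℕ) →+ ℤ}

theorem hasInitial_one : HasInitial w (1 : MvPolynomial σ K) 0 := by
  classical
  refine ⟨by simp, fun e he h => ?_⟩
  rw [MvPolynomial.coeff_one] at he
  simp [Ne.symm h] at he

theorem HasInitial.mul {f g : MvPolynomial σ K} {d d' : σ →₀ ℕ}
    (hf : HasInitial w f d) (hg : HasInitial w g d') : HasInitial w (f * g) (d + d') := by
  classical
  have le_f : ∀ x, f.coeff x ≠ 0 → w d ≤ w x := fun x hx => by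
    by_cases h : x = d
    · rw [h]
    · exact (hf.2 x hx h).le
  have le_g : ∀ x, g.coeff x ≠ 0 → w d' ≤ w x := fun x hx => by
    by_cases h : x = d'
    · rw [h]
    · exact (hg.2 x hx h).le
  have key : ∀ x y, f.coeff x * g.coeff y ≠ 0 → (x, y) ≠ (d, d') → w (d + d') < w (x + y) := by
    intro x y hxy hne
    have hx := left_ne_zero_of_mul hxy
    have hy := right_ne_zero_of_mul hxy
    rw [map_add, map_add]
    by_cases h : x = d
    · have h' : y ≠ d' := fun h' => hne (by rw [h, h'])
      exact add_lt_add_of_le_of_lt (le_f x hx) (hg.2 y hy h')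
    · exact add_lt_add_of_lt_of_le (hf.2 x hx h) (le_g y hy)
  refine ⟨?_, fun e he hne => ?_⟩
  · rw [MvPolynomial.coeff_mul, Finset.sum_eq_single (d, d'), hf.1, hg.1, one_mul]
    · rintro ⟨x, y⟩ hmem hne
      by_contra h
      have := key x y h hne
      rw [Finset.HasAntidiagonal.mem_antidiagonal.1 hmem] at this
      exact lt_irrefl _ this
    · simp
  · rw [MvPolynomial.coeff_mul] at he
    obtain ⟨⟨x, y⟩, hmem, hxy⟩ := Finset.exists_ne_zero_of_sum_ne_zero he
    have hadd : x + y = e := Finset.HasAntidiagonal.mem_antidiagonal.1 hmem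
    rw [← hadd]
    refine key x y hxy fun h => hne ?_
    rw [Prod.mk.injEq] at h
    rw [← hadd, h.1, h.2]

theorem HasInitial.list_prod {ι : Type*} {F : ι → MvPolynomial σ K} {D : ι → σ →₀ ℕ}
    (h : ∀ i, HasInitial w (F i) (D i)) (L : List ι) :
    HasInitial w (L.map F).prod (L.map D).sum := by
  induction L with
  | nil => simpa using hasInitial_one
  | cons a L ih => simpa using (h a).mul ih

theorem hasInitial_sum_monomial {ι : Type*} [Fintype ι] (e : ι → σ →₀ ℕ) (c : ι → K) (x₀ : ι)
    (h₀ : c x₀ = 1) (h : ∀ x, c x ≠ 0 → x ≠ x₀ → w (e x₀) < w (e x)) :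
    HasInitial w (∑ x, MvPolynomial.monomial (e x) (c x)) (e x₀) := by
  classical
  refine ⟨?_, fun d hd hne => ?_⟩
  · rw [MvPolynomial.coeff_sum, Finset.sum_eq_single x₀]
    · rw [MvPolynomial.coeff_monomial, if_pos rfl, h₀]
    · intro x _ hx
      rw [MvPolynomial.coeff_monomial]
      split_ifs with hex
      · by_contra hcx
        have := h x hcx hx
        rw [hex] at this
        exact lt_irrefl _ this
      · rfl
    · simp
  · rw [MvPolynomial.coeff_sum] at hd
    obtain ⟨x, -, hx⟩ := Finset.exists_ne_zero_of_sum_ne_zero hd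
    rw [MvPolynomial.coeff_monomial] at hx
    obtain ⟨hex, hcx⟩ := ite_ne_right_iff.1 hx
    rw [← hex]
    exact h x hcx fun hxx => hne (by rw [← hex, hxx])

/-- A family of polynomials with pairwise distinct initial monomials is linearly independent. -/
theorem linearIndependent_of_hasInitial {ι : Type*} {F : ι → MvPolynomial σ K}
    {D : ι → σ →₀ ℕ} (h : ∀ i, HasInitial w (F i) (D i)) (hD : Function.Injective D) :
    LinearIndependent K F := by
  classical
  rw [linearIndependent_iff']
  intro s c hc
  by_contra! hne
  obtain ⟨i₁, hi₁, hci₁⟩ := hne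
  obtain ⟨i, hi, hmin⟩ := Finset.exists_min_image (s.filter fun i => c i ≠ 0) (fun i => w (D i))
    ⟨i₁, Finset.mem_filter.2 ⟨hi₁, hci₁⟩⟩
  obtain ⟨his, hci⟩ := Finset.mem_filter.1 hi
  have hcoeff := congrArg (MvPolynomial.coeff (D i)) hc
  rw [MvPolynomial.coeff_sum, Finset.sum_eq_single i] at hcoeff
  · rw [MvPolynomial.coeff_smul, (h i).1] at hcoeff
    exact hci (by simpa using hcoeff)
  · intro j hj hji
    rw [MvPolynomial.coeff_smul, smul_eq_mul]
    by_contra hcj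
    have h1 := (h j).2 (D i) (right_ne_zero_of_mul hcj) fun he => hji (hD he.symm)
    have h2 := hmin j (Finset.mem_filter.2 ⟨hj, left_ne_zero_of_mul hcj⟩)
    exact absurd h1 (not_lt.2 h2)
  · exact fun hn => absurd his hn

end HasInitial

/-- Two lists of naturals bounded by `M`, of the same length and with the same multiplicity of
every value below `M`, are permutations of each other. -/
theorem perm_of_count_eq_of_lt {l l' : List ℕ} {M : ℕ} (hlen : l.length = l'.length)
    (hl : ∀ a ∈ l, a ≤ M) (hl' : ∀ a ∈ l', a ≤ M) (h : ∀ a < M, l.count a = l'.count a) :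
    l.Perm l' := by
  have length_eq : ∀ k : List ℕ, (∀ a ∈ k, a ≤ M) →
      k.length = ∑ a ∈ Finset.range M, k.count a + k.count M := by
    intro k hk
    rw [← Finset.sum_range_succ]
    simpa using (Multiset.sum_count_eq_card (s := Finset.range (M + 1)) (m := (k : Multiset ℕ))
      fun a ha => Finset.mem_range.2 (Nat.lt_succ_of_le (hk a ha))).symm
  have h1 := length_eq l hl
  have h2 := length_eq l' hl'
  have h3 : ∑ a ∈ Finset.range M, l.count a = ∑ a ∈ Finset.range M, l'.count a :=
    Finset.sum_congr rfl fun a ha => h a (Finset.mem_range.1 ha)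
  rw [List.perm_iff_count]
  intro a
  rcases lt_trichotomy a M with ha | ha | ha
  · exact h a ha
  · rw [ha]
    omega
  · rw [List.count_eq_zero_of_not_mem fun hm => absurd (hl a hm) (not_le.2 ha),
      List.count_eq_zero_of_not_mem fun hm => absurd (hl' a hm) (not_le.2 ha)]

/-- A list of naturals bounded by `M` has as many entries as it has zeros and values
`1, …, M`. -/
theorem length_eq_count_zero_add_sum {l : List ℕ} {M : ℕ} (hl : ∀ a ∈ l, a ≤ M) :
    l.length = l.count 0 + ∑ i : Fin M, l.count ((i : ℕ) + 1) := by
  rw [Fin.sum_univ_eq_sum_range (fun i => l.count (i + 1)) M, add_comm,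
    ← Finset.sum_range_succ' (fun i => l.count i)]
  simpa using (Multiset.sum_count_eq_card (s := Finset.range (M + 1)) (m := (l : Multiset ℕ))
    fun a ha => Finset.mem_range.2 (Nat.lt_succ_of_le (hl a ha))).symm

/-- Expansion of the determinant of a product of rectangular matrices, over the injections of the
row index into the inner index. -/
theorem det_mul_eq_sum_injective {R : Type*} [CommRing R] {s n : ℕ}
    (A : Matrix (Fin s) (Fin n) R) (B : Matrix (Fin n) (Fin s) R) [DecidablePred
      (Function.Injective : (Fin s → Fin n) → Prop)] :
    (A * B).det = ∑ x : (Fin s → Fin n) × Equiv.Perm (Fin s),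
      if Function.Injective x.1 then
        ((Equiv.Perm.sign x.2 : ℤ) : R) *
          ((∏ i, A i (x.1 i)) * ∏ i, B (x.1 (x.2 i)) i) else 0 := by
  have hrow : A * B = Matrix.of fun i => ∑ k, A i k • B k := by
    ext i j
    simp [Matrix.mul_apply]
  have h1 : (A * B).det = ∑ τ : Fin s → Fin n, (∏ i, A i (τ i)) *
      (B.submatrix τ id).det := by
    rw [hrow]
    have := (Matrix.detRowAlternating (n := Fin s) (R := R)).toMultilinearMap.map_sum
      (fun i k => A i k • B k)
    refine this.trans (Finset.sum_congr rfl fun τ _ => ?_)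
    rw [MultilinearMap.map_smul_univ]
    rfl
  rw [h1, Fintype.sum_prod_type]
  refine Finset.sum_congr rfl fun τ _ => ?_
  dsimp only
  split_ifs with hτ
  · rw [Matrix.det_apply', Finset.mul_sum]
    refine Finset.sum_congr rfl fun σ _ => ?_
    simp only [Matrix.submatrix_apply, id]
    ring
  · obtain ⟨i, j, hij, hne⟩ := Function.not_injective_iff.1 hτ
    rw [Matrix.det_zero_of_row_eq hne (by ext k; simp [hij]), mul_zero, Finset.sum_const_zero]

namespace SMB

variable {n m q : ℕ}

/-- The weight of a variable: `u_{i,k}` has weight `(m - i) k` and `ξ_{k,j}` has weight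
`(q - j) k`. -/
def varWeight (n m q : ℕ) : (Fin m × Fin n) ⊕ (Fin n × Fin q) → ℤ
  | Sum.inl (i, k) => ((m : ℤ) - i) * k
  | Sum.inr (k, j) => ((q : ℤ) - j) * k

/-- The additive weight of a monomial. -/
noncomputable def monWeight (n m q : ℕ) : (((Fin m × Fin n) ⊕ (Fin n × Fin q)) →₀ ℕ) →+ ℤ :=
  Finsupp.weight (varWeight n m q)

/-- The exponent of the diagonal monomial of the regular function attached to an element
of `H`. -/
noncomputable def diagExp : HElt n m q → (((Fin m × Fin n) ⊕ (Fin n × Fin q)) →₀ ℕ)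
  | Sum.inl I => ∑ i, Finsupp.single (Sum.inl (I.f i, i)) 1
  | Sum.inr (Sum.inl J) => ∑ i, Finsupp.single (Sum.inr (i, J.f i)) 1
  | Sum.inr (Sum.inr P) =>
      ∑ i, Finsupp.single (Sum.inl (P.val.rows i, Fin.castLE P.property.2 i)) 1 +
        ∑ i, Finsupp.single (Sum.inr (Fin.castLE P.property.2 i, P.val.cols i)) 1

theorem monWeight_sum_inl {s : ℕ} (r : Fin s → Fin m) (c : Fin s → Fin n) :
    monWeight n m q (∑ i, Finsupp.single (Sum.inl (r i, c i)) 1) =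
      ∑ i, ((m : ℤ) - r i) * ((c i : ℕ) : ℤ) := by
  rw [map_sum]
  simp [monWeight, Finsupp.weight_single, varWeight]

theorem monWeight_sum_inr {s : ℕ} (r : Fin s → Fin n) (c : Fin s → Fin q) :
    monWeight n m q (∑ i, Finsupp.single (Sum.inr (r i, c i)) 1) =
      ∑ i, ((q : ℤ) - c i) * ((r i : ℕ) : ℤ) := by
  rw [map_sum]
  simp [monWeight, Finsupp.weight_single, varWeight]

theorem eq_val_or_sum_sub_mul_lt {s N : ℕ} (a : Fin s → Fin N) (ha : StrictMono a)
    (τ : Fin s → Fin n) (hτ : Function.Injective τ) :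
    (∀ i, (τ i : ℕ) = i) ∨
      ∑ i, ((N : ℤ) - a i) * ((i : ℕ) : ℤ) < ∑ i, ((N : ℤ) - a i) * ((τ i : ℕ) : ℤ) :=
  eq_val_or_sum_mul_lt (fun i => (N : ℤ) - a i)
    (fun i j hij => by have : (a i : ℕ) < a j := ha hij; dsimp only; omega)
    (fun i => by have := (a i).isLt; omega) (fun i => τ i) (Fin.val_injective.comp hτ)

theorem prod_X_eq_monomial {K σ : Type*} [CommSemiring K] {s : ℕ} (v : Fin s → σ) :
    ∏ i, (MvPolynomial.X (v i) : MvPolynomial σ K) =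
      MvPolynomial.monomial (∑ i, Finsupp.single (v i) 1) 1 := by
  rw [MvPolynomial.monomial_sum_one]
  rfl

theorem intCast_mul_monomial {K σ : Type*} [CommRing K] (z : ℤ) (d : σ →₀ ℕ) :
    (z : MvPolynomial σ K) * MvPolynomial.monomial d 1 = MvPolynomial.monomial d (z : K) := by
  rw [← map_intCast (MvPolynomial.C (σ := σ) (R := K)), MvPolynomial.C_mul_monomial, mul_one]

variable (K : Type) [Field K]

theorem hasInitial_uPoly (I : IncTup n m) :
    HasInitial (monWeight n m q) (uPoly K n m q I.f) (diagExp (Sum.inl I)) := by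
  have hexp : uPoly K n m q I.f = ∑ σ : Equiv.Perm (Fin n),
      MvPolynomial.monomial (∑ i, Finsupp.single (Sum.inl (I.f i, σ i)) 1)
        ((Equiv.Perm.sign σ : ℤ) : K) := by
    rw [uPoly, ← Matrix.det_transpose, Matrix.det_apply']
    refine Finset.sum_congr rfl fun σ _ => ?_
    simp only [Matrix.transpose_apply, Matrix.of_apply]
    rw [prod_X_eq_monomial, intCast_mul_monomial]
  rw [hexp]
  refine hasInitial_sum_monomial (w := monWeight n m q)
    (fun σ : Equiv.Perm (Fin n) => ∑ i, Finsupp.single (Sum.inl (I.f i, σ i)) 1) _ 1 (by simp) ?_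
  intro σ _ hσ
  rw [monWeight_sum_inl, monWeight_sum_inl]
  exact (eq_val_or_sum_sub_mul_lt I.f I.mono σ σ.injective).resolve_left
    fun h => hσ (Equiv.ext fun i => Fin.ext (h i))

theorem hasInitial_xiPoly (J : IncTup n q) :
    HasInitial (monWeight n m q) (xiPoly K n m q J.f) (diagExp (Sum.inr (Sum.inl J))) := by
  have hexp : xiPoly K n m q J.f = ∑ σ : Equiv.Perm (Fin n),
      MvPolynomial.monomial (∑ i, Finsupp.single (Sum.inr (σ i, J.f i)) 1)
        ((Equiv.Perm.sign σ : ℤ) : K) := by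
    rw [xiPoly, Matrix.det_apply']
    refine Finset.sum_congr rfl fun σ _ => ?_
    simp only [Matrix.of_apply]
    rw [prod_X_eq_monomial, intCast_mul_monomial]
  rw [hexp]
  refine hasInitial_sum_monomial (w := monWeight n m q)
    (fun σ : Equiv.Perm (Fin n) => ∑ i, Finsupp.single (Sum.inr (σ i, J.f i)) 1) _ 1 (by simp) ?_
  intro σ _ hσ
  rw [monWeight_sum_inr, monWeight_sum_inr]
  exact (eq_val_or_sum_sub_mul_lt J.f J.mono σ σ.injective).resolve_left
    fun h => hσ (Equiv.ext fun i => Fin.ext (h i))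

theorem hasInitial_pPoly (P : {x : PairIx m q // 0 < x.s ∧ x.s ≤ n}) :
    HasInitial (monWeight n m q) (pPoly K n m q P.val) (diagExp (Sum.inr (Sum.inr P))) := by
  classical
  obtain ⟨⟨s, a, b, ha, hb⟩, hs0, hs⟩ := P
  have hexp : pPoly K n m q ⟨s, a, b, ha, hb⟩ = ∑ x : (Fin s → Fin n) × Equiv.Perm (Fin s),
      MvPolynomial.monomial (∑ i, Finsupp.single (Sum.inl (a i, x.1 i)) 1 +
          ∑ i, Finsupp.single (Sum.inr (x.1 (x.2 i), b i)) 1)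
        (if Function.Injective x.1 then ((Equiv.Perm.sign x.2 : ℤ) : K) else 0) := by
    have hmul : (Matrix.of fun i j : Fin s => (Ugen K n m q * Wgen K n m q) (a i) (b j)) =
        (Ugen K n m q).submatrix a id * (Wgen K n m q).submatrix id b := by
      ext1 i j
      simp [Matrix.mul_apply]
    change Matrix.det (Matrix.of fun i j : Fin s =>
      (Ugen K n m q * Wgen K n m q) (a i) (b j)) = _
    rw [hmul, det_mul_eq_sum_injective]
    refine Finset.sum_congr rfl fun x _ => ?_
    split_ifs with hx
    · simp only [Matrix.submatrix_apply, id, Ugen, Wgen, Matrix.of_apply]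
      rw [prod_X_eq_monomial, prod_X_eq_monomial, MvPolynomial.monomial_mul, one_mul,
        intCast_mul_monomial]
    · rw [MvPolynomial.monomial_zero]
  rw [hexp]
  refine hasInitial_sum_monomial (w := monWeight n m q)
    (fun x : (Fin s → Fin n) × Equiv.Perm (Fin s) =>
      ∑ i, Finsupp.single (Sum.inl (a i, x.1 i)) 1 +
        ∑ i, Finsupp.single (Sum.inr (x.1 (x.2 i), b i)) 1) _ (Fin.castLE hs, 1)
    (by simp [Fin.castLE_injective]) ?_
  rintro ⟨τ, σ⟩ hc hne
  have hτ : Function.Injective τ := (ite_ne_right_iff.1 hc).1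
  dsimp only
  rw [map_add, map_add, monWeight_sum_inl, monWeight_sum_inl, monWeight_sum_inr,
    monWeight_sum_inr]
  simp only [Fin.val_castLE, Equiv.Perm.coe_one, id]
  have hA := eq_val_or_sum_sub_mul_lt a ha τ hτ
  have hB := eq_val_or_sum_sub_mul_lt b hb (fun i => τ (σ i)) (hτ.comp σ.injective)
  rcases hA with hA | hA
  · rcases hB with hB | hB
    · refine absurd (Prod.ext (funext fun i => Fin.ext (hA i)) (Equiv.ext fun i => Fin.ext ?_)) hne
      rw [← hA (σ i)]
      exact hB i
    · simp only [hA] at hB ⊢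
      linarith
  · rcases hB with hB | hB
    · simp only [hB]
      linarith
    · linarith

theorem hasInitial_polyOf (h : HElt n m q) :
    HasInitial (monWeight n m q) (polyOf K n m q h) (diagExp h) := by
  rcases h with I | J | P
  · exact hasInitial_uPoly K I
  · exact hasInitial_xiPoly K J
  · exact hasInitial_pPoly K P

end SMB

namespace SMB

variable {n m q : ℕ}

/-- The `j`-th entry of a tuple with values in `Fin N`, shifted by one, and `N + 1` past its
end. -/
def padEntry {s N : ℕ} (f : Fin s → Fin N) (j : ℕ) : ℕ :=
  if h : j < s then (f ⟨j, h⟩ : ℕ) + 1 else N + 1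

theorem padEntry_pos {s N : ℕ} (f : Fin s → Fin N) (j : ℕ) : padEntry f j ≠ 0 := by
  unfold padEntry
  split_ifs <;> omega

theorem padEntry_le {s N : ℕ} (f : Fin s → Fin N) (j : ℕ) : padEntry f j ≤ N + 1 := by
  unfold padEntry
  split_ifs with h <;> omega

theorem padEntry_le_of_lt {s N : ℕ} (f : Fin s → Fin N) {j : ℕ} (h : j < s) :
    padEntry f j ≤ N := by
  rw [padEntry, dif_pos h]
  exact (f ⟨j, h⟩).isLt

theorem padEntry_of_le {s N : ℕ} (f : Fin s → Fin N) {j : ℕ} (h : s ≤ j) :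
    padEntry f j = N + 1 :=
  dif_neg (not_lt.2 h)

theorem padEntry_le_padEntry {s s' N : ℕ} {f : Fin s → Fin N} {g : Fin s' → Fin N}
    (h : geTup f g) (j : ℕ) : padEntry g j ≤ padEntry f j := by
  obtain ⟨hs, hfg⟩ := h
  by_cases hj : j < s
  · rw [padEntry, padEntry, dif_pos hj, dif_pos (hj.trans_le hs)]
    exact Nat.succ_le_succ (hfg ⟨j, hj⟩)
  · rw [padEntry_of_le f (not_lt.1 hj)]
    exact padEntry_le g j

theorem le_of_padEntry_eq {s s' N n : ℕ} {f : Fin s → Fin N} {g : Fin s' → Fin N}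
    (hs' : s' ≤ n) (h : ∀ j : Fin n, padEntry f j = padEntry g j) : s' ≤ s := by
  by_contra! hlt
  have h1 := h ⟨s, hlt.trans_le hs'⟩
  have h2 := padEntry_le_of_lt g hlt
  rw [padEntry_of_le f le_rfl] at h1
  dsimp only at h1
  omega

theorem eq_of_padEntry_eq {s N n : ℕ} {f g : Fin s → Fin N} (hs : s ≤ n)
    (h : ∀ j : Fin n, padEntry f j = padEntry g j) : f = g := by
  ext i
  have := h (Fin.castLE hs i)
  simpa [padEntry] using this

theorem sum_single_eq_padEntry {σ : Type*} {s N n : ℕ} (f : Fin s → Fin N) (hs : s ≤ n)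
    (i : Fin N) (j : Fin n) (v : Fin s → σ) (x : σ)
    (hv : ∀ k, v k = x ↔ f k = i ∧ Fin.castLE hs k = j) :
    (∑ k, Finsupp.single (v k) 1 : σ →₀ ℕ) x = if padEntry f j = (i : ℕ) + 1 then 1 else 0 := by
  classical
  simp only [Finsupp.finsetSum_apply, Finsupp.single_apply, hv]
  by_cases hj : (j : ℕ) < s
  · rw [Finset.sum_eq_single ⟨j, hj⟩]
    · simp [padEntry, hj, Fin.ext_iff]
    · exact fun k _ hk => if_neg fun h => hk (by simpa [Fin.ext_iff] using h.2)
    · simp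
  · rw [padEntry_of_le f (not_lt.1 hj), if_neg (by omega)]
    refine Finset.sum_eq_zero fun k _ => if_neg fun h => hj ?_
    rw [← h.2]
    exact k.isLt

/-- The padded row tableau of an element of `H`; it vanishes identically on `H_ξ`. -/
def uEntry : HElt n m q → Fin n → ℕ
  | Sum.inl I, j => padEntry I.f j
  | Sum.inr (Sum.inl _), _ => 0
  | Sum.inr (Sum.inr P), j => padEntry P.val.rows j

/-- The padded column tableau of an element of `H`; it vanishes identically on `H_u`. -/
def xiEntry : HElt n m q → Fin n → ℕ
  | Sum.inl _, _ => 0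
  | Sum.inr (Sum.inl J), j => padEntry J.f j
  | Sum.inr (Sum.inr P), j => padEntry P.val.cols j

theorem uEntry_le (h : HElt n m q) (j : Fin n) : uEntry h j ≤ m + 1 := by
  rcases h with I | J | P
  · exact padEntry_le _ _
  · exact Nat.zero_le _
  · exact padEntry_le _ _

theorem xiEntry_le (h : HElt n m q) (j : Fin n) : xiEntry h j ≤ q + 1 := by
  rcases h with I | J | P
  · exact Nat.zero_le _
  · exact padEntry_le _ _
  · exact padEntry_le _ _

theorem uEntry_zero_le (hn : 0 < n) (h : HElt n m q) : uEntry h ⟨0, hn⟩ ≤ m := by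
  rcases h with I | J | P
  · exact padEntry_le_of_lt _ hn
  · exact Nat.zero_le _
  · exact padEntry_le_of_lt _ P.property.1

theorem xiEntry_zero_le (hn : 0 < n) (h : HElt n m q) : xiEntry h ⟨0, hn⟩ ≤ q := by
  rcases h with I | J | P
  · exact Nat.zero_le _
  · exact padEntry_le_of_lt _ hn
  · exact padEntry_le_of_lt _ P.property.1

theorem uEntry_eq_zero_iff (h : HElt n m q) (j : Fin n) :
    uEntry h j = 0 ↔ ∃ J, h = Sum.inr (Sum.inl J) := by
  rcases h with I | J | P <;> simp [uEntry, padEntry_pos]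

theorem xiEntry_eq_zero_iff (h : HElt n m q) (j : Fin n) :
    xiEntry h j = 0 ↔ ∃ I, h = Sum.inl I := by
  rcases h with I | J | P <;> simp [xiEntry, padEntry_pos]

theorem geTup_of_forall_le {N : ℕ} {f g : Fin n → Fin N} (h : ∀ j, g j ≤ f j) : geTup f g :=
  ⟨le_rfl, h⟩

theorem uEntry_mono {a b : HElt n m q} (h : hle a b) (j : Fin n) : uEntry a j ≤ uEntry b j := by
  rcases a with I | J | P <;> rcases b with I' | J' | P'
  · exact padEntry_le_padEntry (geTup_of_forall_le h) j
  · exact h.elim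
  · exact padEntry_le_padEntry h j
  · exact h.elim
  · exact Nat.zero_le _
  · exact Nat.zero_le _
  · exact h.elim
  · exact h.elim
  · exact padEntry_le_padEntry h.1 j

theorem xiEntry_mono {a b : HElt n m q} (h : hle a b) (j : Fin n) :
    xiEntry a j ≤ xiEntry b j := by
  rcases a with I | J | P <;> rcases b with I' | J' | P'
  · exact Nat.zero_le _
  · exact h.elim
  · exact Nat.zero_le _
  · exact h.elim
  · exact padEntry_le_padEntry (geTup_of_forall_le h) j
  · exact padEntry_le_padEntry h j
  · exact h.elim
  · exact h.elim
  · exact padEntry_le_padEntry h.2 j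

theorem helt_ext (hn : 0 < n) {a b : HElt n m q} (hu : ∀ j, uEntry a j = uEntry b j)
    (hxi : ∀ j, xiEntry a j = xiEntry b j) : a = b := by
  have hu0 := (uEntry_eq_zero_iff a ⟨0, hn⟩).symm.trans
    (hu ⟨0, hn⟩ ▸ uEntry_eq_zero_iff b ⟨0, hn⟩)
  have hxi0 := (xiEntry_eq_zero_iff a ⟨0, hn⟩).symm.trans
    (hxi ⟨0, hn⟩ ▸ xiEntry_eq_zero_iff b ⟨0, hn⟩)
  rcases a with ⟨f, hf⟩ | ⟨f, hf⟩ | ⟨⟨s, r, c, hr, hc⟩, hs0, hs⟩ <;>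
    rcases b with ⟨f', hf'⟩ | ⟨f', hf'⟩ | ⟨⟨s', r', c', hr', hc'⟩, hs0', hs'⟩ <;>
    simp at hu0 hxi0
  · obtain rfl : f = f' := eq_of_padEntry_eq le_rfl hu
    rfl
  · obtain rfl : f = f' := eq_of_padEntry_eq le_rfl hxi
    rfl
  · dsimp only at hs hs'
    obtain rfl : s = s' :=
      le_antisymm (le_of_padEntry_eq hs fun j => (hu j).symm) (le_of_padEntry_eq hs' hu)
    obtain rfl : r = r' := eq_of_padEntry_eq hs hu
    obtain rfl : c = c' := eq_of_padEntry_eq hs hxi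
    rfl

theorem sum_single_apply_eq_zero {σ ι : Type*} [Fintype ι] (v : ι → σ) (x : σ)
    (hv : ∀ k, v k ≠ x) : (∑ k, Finsupp.single (v k) 1 : σ →₀ ℕ) x = 0 := by
  rw [Finsupp.finsetSum_apply]
  exact Finset.sum_eq_zero fun k _ => Finsupp.single_eq_of_ne (hv k).symm

theorem diagExp_inl (h : HElt n m q) (i : Fin m) (j : Fin n) :
    diagExp h (Sum.inl (i, j)) = if uEntry h j = (i : ℕ) + 1 then 1 else 0 := by
  rcases h with I | J | P
  · exact sum_single_eq_padEntry I.f le_rfl i j _ _ fun k => by simp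
  · exact (sum_single_apply_eq_zero _ _ fun k => by simp).trans (by simp [uEntry])
  · rw [diagExp, Finsupp.add_apply, sum_single_eq_padEntry P.val.rows P.property.2 i j _ _
      fun k => by simp, sum_single_apply_eq_zero _ _ fun k => by simp, add_zero]
    rfl

theorem diagExp_inr (h : HElt n m q) (i : Fin q) (j : Fin n) :
    diagExp h (Sum.inr (j, i)) = if xiEntry h j = (i : ℕ) + 1 then 1 else 0 := by
  rcases h with I | J | P
  · exact (sum_single_apply_eq_zero _ _ fun k => by simp).trans (by simp [xiEntry])
  · exact sum_single_eq_padEntry J.f le_rfl i j _ _ fun k => by simp [and_comm]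
  · rw [diagExp, Finsupp.add_apply, sum_single_apply_eq_zero _ _ fun k => by simp, zero_add]
    exact sum_single_eq_padEntry P.val.cols P.property.2 i j _ _ fun k => by
      rw [Sum.inr.injEq, Prod.mk.injEq, and_comm]

theorem sum_diagExp_inl (L : List (HElt n m q)) (i : Fin m) (j : Fin n) :
    (L.map diagExp).sum (Sum.inl (i, j)) = (L.map fun h => uEntry h j).count ((i : ℕ) + 1) := by
  induction L with
  | nil => rfl
  | cons a L ih => simp [List.count_cons, ih, diagExp_inl, add_comm]

theorem sum_diagExp_inr (L : List (HElt n m q)) (i : Fin q) (j : Fin n) :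
    (L.map diagExp).sum (Sum.inr (j, i)) = (L.map fun h => xiEntry h j).count ((i : ℕ) + 1) := by
  induction L with
  | nil => rfl
  | cons a L ih => simp [List.count_cons, ih, diagExp_inr, add_comm]

theorem count_zero_uEntry (L : List (HElt n m q)) (j j' : Fin n) :
    (L.map fun h => uEntry h j).count 0 = (L.map fun h => uEntry h j').count 0 := by
  induction L with
  | nil => rfl
  | cons a L ih =>
    have h : (uEntry a j == 0) = (uEntry a j' == 0) := by
      rw [Bool.eq_iff_iff, beq_iff_eq, beq_iff_eq, uEntry_eq_zero_iff, uEntry_eq_zero_iff]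
    simp only [List.map_cons, List.count_cons, ih, h]

theorem count_zero_xiEntry (L : List (HElt n m q)) (j j' : Fin n) :
    (L.map fun h => xiEntry h j).count 0 = (L.map fun h => xiEntry h j').count 0 := by
  induction L with
  | nil => rfl
  | cons a L ih =>
    have h : (xiEntry a j == 0) = (xiEntry a j' == 0) := by
      rw [Bool.eq_iff_iff, beq_iff_eq, beq_iff_eq, xiEntry_eq_zero_iff, xiEntry_eq_zero_iff]
    simp only [List.map_cons, List.count_cons, ih, h]

theorem IsStandardList.count_zero {L : List (HElt n m q)} (hL : IsStandardList L) (j : Fin n) :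
    (L.map fun h => uEntry h j).count 0 = 0 ∨ (L.map fun h => xiEntry h j).count 0 = 0 := by
  by_contra! hne
  obtain ⟨a, ha, ha0⟩ := List.mem_map.1 (List.count_pos_iff.1 (Nat.pos_of_ne_zero hne.1))
  obtain ⟨b, hb, hb0⟩ := List.mem_map.1 (List.count_pos_iff.1 (Nat.pos_of_ne_zero hne.2))
  obtain ⟨J, rfl⟩ := (uEntry_eq_zero_iff a j).1 ha0
  obtain ⟨I, rfl⟩ := (xiEntry_eq_zero_iff b j).1 hb0
  exact hL.1 ⟨⟨I, hb⟩, ⟨J, ha⟩⟩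

theorem IsStandardList.pairwise_map {L : List (HElt n m q)} (hL : IsStandardList L)
    {e : HElt n m q → ℕ} (he : ∀ a b, hle a b → e a ≤ e b) : (L.map e).Pairwise (· ≥ ·) := by
  rw [← List.isChain_iff_pairwise, List.isChain_map]
  exact List.IsChain.imp (fun a b h => he b a h) hL.2

theorem sum_diagExp_injective (hn : 0 < n) {L L' : List (HElt n m q)} (hL : IsStandardList L)
    (hL' : IsStandardList L') (h : (L.map diagExp).sum = (L'.map diagExp).sum) : L = L' := by
  have hu (i : Fin m) (j : Fin n) : (L.map fun h => uEntry h j).count ((i : ℕ) + 1) =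
      (L'.map fun h => uEntry h j).count ((i : ℕ) + 1) := by
    rw [← sum_diagExp_inl, ← sum_diagExp_inl, h]
  have hxi (i : Fin q) (j : Fin n) : (L.map fun h => xiEntry h j).count ((i : ℕ) + 1) =
      (L'.map fun h => xiEntry h j).count ((i : ℕ) + 1) := by
    rw [← sum_diagExp_inr, ← sum_diagExp_inr, h]
  have length_u (M : List (HElt n m q)) :=
    length_eq_count_zero_add_sum (l := M.map fun h => uEntry h ⟨0, hn⟩) (M := m) fun a ha => by
      obtain ⟨x, -, rfl⟩ := List.mem_map.1 ha
      exact uEntry_zero_le hn x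
  have length_xi (M : List (HElt n m q)) :=
    length_eq_count_zero_add_sum (l := M.map fun h => xiEntry h ⟨0, hn⟩) (M := q) fun a ha => by
      obtain ⟨x, -, rfl⟩ := List.mem_map.1 ha
      exact xiEntry_zero_le hn x
  simp only [List.length_map] at length_u length_xi
  have hlu := length_u L
  have hlxi := length_xi L
  simp only [hu] at hlu
  simp only [hxi] at hlxi
  have hlu' := length_u L'
  have hlxi' := length_xi L'
  have hz := hL.count_zero ⟨0, hn⟩
  have hz' := hL'.count_zero ⟨0, hn⟩
  have hlen : L.length = L'.length := by omega
  have columns_u (j : Fin n) : (L.map fun h => uEntry h j) = L'.map fun h => uEntry h j := by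
    refine List.Perm.eq_of_pairwise' (r := (· ≥ ·))
      (hL.pairwise_map fun a b hab => uEntry_mono hab j)
      (hL'.pairwise_map fun a b hab => uEntry_mono hab j)
      (perm_of_count_eq_of_lt (M := m + 1) (by simpa using hlen) ?_ ?_ ?_)
    · exact List.forall_mem_map.2 fun x _ => uEntry_le x j
    · exact List.forall_mem_map.2 fun x _ => uEntry_le x j
    · rintro (_ | a) ha
      · rw [count_zero_uEntry L j ⟨0, hn⟩, count_zero_uEntry L' j ⟨0, hn⟩]
        omega
      · exact hu ⟨a, by omega⟩ j
  have columns_xi (j : Fin n) : (L.map fun h => xiEntry h j) = L'.map fun h => xiEntry h j := by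
    refine List.Perm.eq_of_pairwise' (r := (· ≥ ·))
      (hL.pairwise_map fun a b hab => xiEntry_mono hab j)
      (hL'.pairwise_map fun a b hab => xiEntry_mono hab j)
      (perm_of_count_eq_of_lt (M := q + 1) (by simpa using hlen) ?_ ?_ ?_)
    · exact List.forall_mem_map.2 fun x _ => xiEntry_le x j
    · exact List.forall_mem_map.2 fun x _ => xiEntry_le x j
    · rintro (_ | a) ha
      · rw [count_zero_xiEntry L j ⟨0, hn⟩, count_zero_xiEntry L' j ⟨0, hn⟩]
        omega
      · exact hxi ⟨a, by omega⟩ j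
  refine List.ext_getElem hlen fun t ht ht' => helt_ext hn (fun j => ?_) fun j => ?_
  · have := congrArg (fun l : List ℕ => l[t]?) (columns_u j)
    simpa [ht, ht'] using this
  · have := congrArg (fun l : List ℕ => l[t]?) (columns_xi j)
    simpa [ht, ht'] using this

end SMB

open SMB in
/-- **Linear independence of standard monomials.**
The standard monomials in the regular functions `p(A,B)` (`(A,B) ∈ H_p`), `u(I)`
(`I ∈ H_u`), `ξ(J)` (`J ∈ H_ξ`) — including the empty monomial `1` — are linearly
independent over `K` in `K[X]`. -/
theorem standard_monomials_linearly_independent (K : Type) [Field K] [IsAlgClosed K]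
    (n m q : ℕ) (hn : 0 < n) (hm : n < m) (hq : n < q) :
    LinearIndependent K
      (fun L : {L : List (HElt n m q) // IsStandardList L} =>
        (L.val.map (polyOf K n m q)).prod) := by
  exact linearIndependent_of_hasInitial
    (fun L => HasInitial.list_prod (hasInitial_polyOf K) L.val)
    fun L L' h => Subtype.ext (sum_diagExp_injective hn L.property L'.property h)
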